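/- Let N ≥ 3 be an integer. For γ ∈ (0, π) define the best Hardy constant of the cone C_γ by μ(γ) = inf{∫_{C_γ} |∇u(x)|² dx / ∫_{C_γ} u(x)²/|x|² dx : u ∈ C_c^∞(C_γ), ∫_{C_γ} u²/|x|² dx > 0}. Then μ(π/2) = N²/4 and μ is continuous at γ = π/2: for every ε > 0 there exists δ > 0 such that |μ(γ) − N²/4| < ε whenever γ ∈ (0, π) and |γ − π/2| < δ. -/

import Mathlib

open Real MeasureTheory

/-- The last coordinate `x_N` of a point `x ∈ ℝ^N`. -/
noncomputable def lastCoord {N : ℕ} (x : EuclideanSpace ℝ (Fin N)) : ℝ :=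
  ∑ i : Fin N, if (i : ℕ) + 1 = N then x i else 0

/-- The open cone of aperture `γ`: `C_γ = {x : |x| > 0 ∧ x_N > |x| cos γ}`. -/
def cone (N : ℕ) (γ : ℝ) : Set (EuclideanSpace ℝ (Fin N)) :=
  {x | 0 < ‖x‖ ∧ ‖x‖ * Real.cos γ < lastCoord x}

/-- The best Hardy constant `μ(C_γ)` of the cone of aperture `γ`. -/
noncomputable def coneHardyConst (N : ℕ) (γ : ℝ) : ℝ :=
  sInf {ρ : ℝ | ∃ u : EuclideanSpace ℝ (Fin N) → ℝ,
    ContDiff ℝ (⊤ : ℕ∞) u ∧ HasCompactSupport u ∧ tsupport u ⊆ cone N γ ∧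
    0 < (∫ x in cone N γ, (u x) ^ 2 / ‖x‖ ^ 2) ∧
    ρ = (∫ x in cone N γ, ‖gradient u x‖ ^ 2) / ∫ x in cone N γ, (u x) ^ 2 / ‖x‖ ^ 2}



lemma int_fderiv_zero {N : ℕ} {g : EuclideanSpace ℝ (Fin N) → ℝ} (hg : ContDiff ℝ 1 g)
    (hc : HasCompactSupport g) (v : EuclideanSpace ℝ (Fin N)) :
    ∫ x, fderiv ℝ g x v = 0 := by
  have hcont : Continuous (fun x => fderiv ℝ g x v) :=
    (hg.continuous_fderiv (by norm_num)).clm_apply continuous_const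
  have hcs : HasCompactSupport (fun x => fderiv ℝ g x v) := hc.fderiv_apply ℝ v
  have := integral_mul_fderiv_eq_neg_fderiv_mul_of_integrable (𝕜 := ℝ)
    (μ := (volume : Measure (EuclideanSpace ℝ (Fin N)))) (f := fun _ => (1:ℝ)) (g := g) (v := v)
    (by simp) (by simpa using hcont.integrable_of_hasCompactSupport hcs)
    (by simpa using hg.continuous.integrable_of_hasCompactSupport hc)
    (fun x _ => by fun_prop) (fun x _ => hg.differentiable (by norm_num) x)
  simpa using this

lemma int_euler {N : ℕ} {g : EuclideanSpace ℝ (Fin N) → ℝ} (hg : ContDiff ℝ 1 g)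
    (hc : HasCompactSupport g) :
    ∫ x, ((N : ℝ) * g x + fderiv ℝ g x x) = 0 := by
  have hcont : ∀ v, Continuous (fun x => fderiv ℝ g x v) := fun v =>
    (hg.continuous_fderiv (by norm_num)).clm_apply continuous_const
  have hcs : ∀ v, HasCompactSupport (fun x => fderiv ℝ g x v) := fun v => hc.fderiv_apply ℝ v
  have hgi := hg.continuous.integrable_of_hasCompactSupport (μ := volume) hc
  have hI : ∀ i : Fin N, Integrable
      (fun x : EuclideanSpace ℝ (Fin N) => fderiv ℝ g x (EuclideanSpace.single i 1) * x i) := by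
    intro i
    apply Continuous.integrable_of_hasCompactSupport
    · exact (hcont _).mul (by fun_prop)
    · exact (hcs _).mul_right
  have key : ∀ i : Fin N, ∫ x : EuclideanSpace ℝ (Fin N),
      fderiv ℝ g x (EuclideanSpace.single i 1) * x i = - ∫ x, g x := by
    intro i
    have hfd : ∀ x : EuclideanSpace ℝ (Fin N),
        fderiv ℝ (fun y : EuclideanSpace ℝ (Fin N) => y i) x = EuclideanSpace.proj i := fun x =>
      (EuclideanSpace.proj (𝕜 := ℝ) i).hasFDerivAt.fderiv
    have := integral_mul_fderiv_eq_neg_fderiv_mul_of_integrable (𝕜 := ℝ)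
      (μ := (volume : Measure (EuclideanSpace ℝ (Fin N))))
      (f := g) (g := fun y : EuclideanSpace ℝ (Fin N) => y i) (v := EuclideanSpace.single i 1)
      (hI i) (by simpa [hfd] using hgi)
      ((hg.continuous.mul (by fun_prop)).integrable_of_hasCompactSupport hc.mul_right)
      (fun x _ => hg.differentiable (by norm_num) x) (fun x _ => by fun_prop)
    simp only [hfd] at this
    simp at this
    linarith
  have hx : ∀ x : EuclideanSpace ℝ (Fin N), fderiv ℝ g x x =
      ∑ i, fderiv ℝ g x (EuclideanSpace.single i 1) * x i := by
    intro x
    have : x = ∑ i, x i • EuclideanSpace.single i (1:ℝ) := by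
      ext j; simp [Finset.sum_apply, Pi.single_apply]
    refine (congrArg (fderiv ℝ g x) this).trans ?_
    rw [map_sum]
    exact Finset.sum_congr rfl fun i _ => by rw [map_smul, smul_eq_mul, mul_comm]
  simp_rw [hx]
  rw [integral_add (hgi.const_mul _) (integrable_finsetSum _ fun i _ => hI i),
    integral_finsetSum _ fun i _ => hI i, integral_const_mul]
  simp [key]

lemma polar {N : ℕ} (hN : 3 ≤ N) (j : Fin N) (F G : ℝ → ℝ) :
    ∫ x : EuclideanSpace ℝ (Fin N), exp (-(N:ℝ) * log ‖x‖) * F (log ‖x‖) * G (x j / ‖x‖)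
    = (∫ s, F s) * ∫ w, G ((w : EuclideanSpace ℝ (Fin N)) j)
        ∂((volume : Measure (EuclideanSpace ℝ (Fin N))).toSphere) := by
  have : Nonempty (Fin N) := ⟨j⟩
  have hd : Module.finrank ℝ (EuclideanSpace ℝ (Fin N)) = N := by simp
  have h1 : ∫ x : EuclideanSpace ℝ (Fin N),
        exp (-(N:ℝ) * log ‖x‖) * F (log ‖x‖) * G (x j / ‖x‖)
    = ∫ p : (Metric.sphere (0:EuclideanSpace ℝ (Fin N)) 1) × (Set.Ioi (0:ℝ)),
        G ((p.1 : EuclideanSpace ℝ (Fin N)) j) * (exp (-(N:ℝ) * log p.2.1) * F (log p.2.1))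
        ∂((volume : Measure (EuclideanSpace ℝ (Fin N))).toSphere.prod
          (Measure.volumeIoiPow (N - 1))) := by
    have h2 := ((volume : Measure (EuclideanSpace ℝ
        (Fin N))).measurePreserving_homeomorphUnitSphereProd).integral_comp
      (Homeomorph.measurableEmbedding _)
      (fun p : (Metric.sphere (0:EuclideanSpace ℝ (Fin N)) 1) × (Set.Ioi (0:ℝ)) =>
        G ((p.1 : EuclideanSpace ℝ (Fin N)) j) * (exp (-(N:ℝ) * log p.2.1) * F (log p.2.1)))
    rw [hd] at h2
    rw [← h2]
    have h3 := integral_subtype_comap (μ := volume)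
      (measurableSet_singleton (0 : EuclideanSpace ℝ (Fin N))).compl
      fun x : EuclideanSpace ℝ (Fin N) ↦ exp (-(N:ℝ) * log ‖x‖) * F (log ‖x‖) * G (x j / ‖x‖)
    rw [restrict_compl_singleton] at h3
    rw [← h3]
    congr 1
    ext x
    simp only [homeomorphUnitSphereProd_apply_snd_coe, homeomorphUnitSphereProd_apply_fst_coe]
    simp
    ring_nf
  rw [h1, integral_prod_mul (fun w : Metric.sphere (0:EuclideanSpace ℝ (Fin N)) 1 =>
     G ((w : EuclideanSpace ℝ (Fin N)) j))
     (fun r : Set.Ioi (0:ℝ) => exp (-(N:ℝ) * log r.1) * F (log r.1))]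
  rw [mul_comm]
  congr 1
  simp only [Measure.volumeIoiPow, ENNReal.ofReal]
  rw [integral_withDensity_eq_integral_smul,
    integral_subtype_comap measurableSet_Ioi fun a : ℝ ↦
      Real.toNNReal (a ^ (N - 1)) • (exp (-(N:ℝ) * log a) * F (log a))]
  · have him : Real.exp '' Set.univ = Set.Ioi 0 := by rw [Set.image_univ, Real.range_exp]
    rw [← him, integral_image_eq_integral_abs_deriv_smul MeasurableSet.univ
      (fun x _ => (Real.hasDerivAt_exp x).hasDerivWithinAt) Real.exp_injective.injOn]
    rw [setIntegral_univ]
    congr 1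
    ext s
    rw [NNReal.smul_def, Real.coe_toNNReal _ (by positivity), Real.log_exp, abs_of_pos (exp_pos _),
      ← Real.exp_nat_mul, smul_eq_mul, smul_eq_mul, ← mul_assoc, ← mul_assoc, ← Real.exp_add,
      ← Real.exp_add, Nat.cast_sub (by omega)]
    have : s + ((N:ℝ) - (1:ℕ)) * s + -N * s = 0 := by push_cast; ring
    rw [this]; simp
  · exact (measurable_subtype_coe.pow_const _).real_toNNReal

lemma hasF_norm {N : ℕ} {x : EuclideanSpace ℝ (Fin N)} (hx : x ≠ 0) :
    HasFDerivAt (fun y : EuclideanSpace ℝ (Fin N) => ‖y‖) (‖x‖⁻¹ • innerSL ℝ x) x := by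
  have h := (hasStrictFDerivAt_norm_sq x).hasFDerivAt
  have hx' : 0 < ‖x‖ := norm_pos_iff.2 hx
  have h2 := h.sqrt (by positivity)
  have h3 : (fun y : EuclideanSpace ℝ (Fin N) => √(‖y‖ ^ 2)) = fun y => ‖y‖ := by
    ext y; exact Real.sqrt_sq (norm_nonneg y)
  rw [h3, Real.sqrt_sq hx'.le] at h2
  refine h2.congr_fderiv ?_
  ext v
  simp
  field_simp

lemma hasF_t {N : ℕ} (j : Fin N) {x : EuclideanSpace ℝ (Fin N)} (hx : x ≠ 0) :
    HasFDerivAt (fun y : EuclideanSpace ℝ (Fin N) => y j / ‖y‖)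
      (‖x‖⁻¹ • EuclideanSpace.proj j - (x j / ‖x‖ ^ 3) • innerSL ℝ x) x := by
  have hx' : ‖x‖ ≠ 0 := (norm_pos_iff.2 hx).ne'
  have hp : HasFDerivAt (fun y : EuclideanSpace ℝ (Fin N) => y j)
    (EuclideanSpace.proj (𝕜 := ℝ) j) x := (EuclideanSpace.proj (𝕜 := ℝ) j).hasFDerivAt
  refine (hp.mul ((hasDerivAt_inv hx').comp_hasFDerivAt x (hasF_norm hx))).congr_fderiv ?_
  ext v
  simp
  field_simp
  ring

lemma contDiffAt_t {N : ℕ} (j : Fin N) {n : WithTop ℕ∞} {x : EuclideanSpace ℝ (Fin N)} (hx : x ≠ 0) :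
    ContDiffAt ℝ n (fun y : EuclideanSpace ℝ (Fin N) => y j / ‖y‖) x := by
  have hx' : ‖x‖ ≠ 0 := (norm_pos_iff.2 hx).ne'
  have hp : ContDiffAt ℝ n (fun y : EuclideanSpace ℝ (Fin N) => y j) x :=
    (EuclideanSpace.proj (𝕜 := ℝ) j).contDiff.contDiffAt
  exact hp.div (contDiffAt_norm ℝ hx) hx'

lemma contDiff_mul_supp {N : ℕ} {n : WithTop ℕ∞} {u w : EuclideanSpace ℝ (Fin N) → ℝ} (hu : ContDiff ℝ n u)
    (hw : ∀ x ∈ tsupport u, ContDiffAt ℝ n w x) : ContDiff ℝ n (fun x => u x * w x) := by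
  rw [contDiff_iff_contDiffAt]
  intro x
  by_cases hx : x ∈ tsupport u
  · exact hu.contDiffAt.mul (hw x hx)
  · have : (fun x => u x * w x) =ᶠ[nhds x] fun _ => 0 := by
      filter_upwards [notMem_tsupport_iff_eventuallyEq.1 hx] with y hy
      simp [hy]
    exact contDiffAt_const.congr_of_eventuallyEq this

/-- the vector field -/
noncomputable def Fv {N : ℕ} (j : Fin N) (k : ℝ) (q : ℝ → ℝ) (x : EuclideanSpace ℝ (Fin N)) :
    EuclideanSpace ℝ (Fin N) :=
  ((k + q (x j / ‖x‖) * (x j / ‖x‖)) / ‖x‖ ^ 2) • x -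
    (q (x j / ‖x‖) / ‖x‖) • EuclideanSpace.single j (1:ℝ)

/-- the potential -/
noncomputable def Vp (N : ℕ) (k : ℝ) (q : ℝ → ℝ) (t : ℝ) : ℝ :=
  k ^ 2 + (N - 1) * (q t * t) - (1 - t ^ 2) * (deriv q t + q t ^ 2)

lemma norm_comb {N : ℕ} (j : Fin N) (D x : EuclideanSpace ℝ (Fin N)) (c a b : ℝ) :
    ‖D + c • (a • x - b • EuclideanSpace.single j (1:ℝ))‖ ^ 2 =
      ‖D‖ ^ 2 + 2 * c * (a * inner ℝ D x - b * D j) +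
      c ^ 2 * (a ^ 2 * ‖x‖ ^ 2 - 2 * a * b * x j + b ^ 2) := by
  rw [norm_add_sq_real, norm_smul, mul_pow, norm_sub_sq_real]
  simp only [norm_smul, inner_smul_right, inner_sub_right, inner_smul_left,
    EuclideanSpace.inner_single_right]
  simp [mul_pow]
  ring

lemma key {N : ℕ} (j : Fin N) (k : ℝ) (hk : 2 * k = N - 2) (q : ℝ → ℝ)
    {u : EuclideanSpace ℝ (Fin N) → ℝ} (hu : ContDiff ℝ 1 u) (hc : HasCompactSupport u)
    (hs : ∀ x ∈ tsupport u, x ≠ 0 ∧ ContDiffAt ℝ 1 q (x j / ‖x‖)) :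
    ∃ R : EuclideanSpace ℝ (Fin N) → ℝ, Integrable R ∧ ∫ x, R x = 0 ∧
      ∀ x, ‖gradient u x‖ ^ 2 = ‖gradient u x + u x • Fv j k q x‖ ^ 2 +
        u x ^ 2 / ‖x‖ ^ 2 * Vp N k q (x j / ‖x‖) + R x := by
  have hsq : ∀ x ∈ tsupport u, ContDiffAt ℝ 1
      (fun y : EuclideanSpace ℝ (Fin N) => q (y j / ‖y‖)) x := fun x hx =>
    ContDiffAt.comp x (hs x hx).2 (contDiffAt_t j (hs x hx).1)
  set w₁ : EuclideanSpace ℝ (Fin N) → ℝ := fun y =>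
    u y * ((k + q (y j / ‖y‖) * (y j / ‖y‖)) / ‖y‖ ^ 2) with hw₁
  set w₂ : EuclideanSpace ℝ (Fin N) → ℝ := fun y => u y * (q (y j / ‖y‖) / ‖y‖) with hw₂
  have hg : ContDiff ℝ 1 (fun x => u x * w₁ x) := by
    refine contDiff_mul_supp hu fun x hx => ?_
    have hx0 := (hs x hx).1
    have hn : ‖x‖ ≠ 0 := (norm_pos_iff.2 hx0).ne'
    exact hu.contDiffAt.mul ((contDiffAt_const.add ((hsq x hx).mul (contDiffAt_t j hx0))).div
      ((contDiffAt_norm ℝ hx0).pow 2) (by positivity))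
  have hh : ContDiff ℝ 1 (fun x => u x * w₂ x) := by
    refine contDiff_mul_supp hu fun x hx => ?_
    have hx0 := (hs x hx).1
    have hn : ‖x‖ ≠ 0 := (norm_pos_iff.2 hx0).ne'
    exact hu.contDiffAt.mul ((hsq x hx).div (contDiffAt_norm ℝ hx0) hn)
  have hgc : HasCompactSupport (fun x => u x * w₁ x) := hc.mul_right
  have hhc : HasCompactSupport (fun x => u x * w₂ x) := hc.mul_right
  have e1 := int_euler hg hgc
  have e2 := int_fderiv_zero hh hhc (EuclideanSpace.single j (1:ℝ))
  have i1 : Integrable (fun x => (N:ℝ) * (u x * w₁ x) + fderiv ℝ (fun x => u x * w₁ x) x x) := by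
    apply Continuous.integrable_of_hasCompactSupport
    · exact (hg.continuous.const_mul _).add
        ((hg.continuous_fderiv (by norm_num)).clm_apply continuous_id)
    · refine HasCompactSupport.add hgc.mul_left ?_
      refine (hgc.fderiv ℝ).mono' ?_
      intro x hx
      apply subset_closure
      intro h
      exact hx (by simp [h])
  have i2 : Integrable (fun x => fderiv ℝ (fun x => u x * w₂ x) x (EuclideanSpace.single j (1:ℝ))) := by
    apply Continuous.integrable_of_hasCompactSupport
    · exact (hh.continuous_fderiv (by norm_num)).clm_apply continuous_const
    · exact hhc.fderiv_apply ℝ _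
  refine ⟨fun x => fderiv ℝ (fun x => u x * w₂ x) x (EuclideanSpace.single j (1:ℝ)) -
    ((N:ℝ) * (u x * w₁ x) + fderiv ℝ (fun x => u x * w₁ x) x x), i2.sub i1, ?_, ?_⟩
  · rw [integral_sub i2 i1, e1, e2]; simp
  intro x
  by_cases hx : x ∈ tsupport u
  · have hx0 := (hs x hx).1
    have hn : 0 < ‖x‖ := norm_pos_iff.2 hx0
    have hud : HasFDerivAt u (fderiv ℝ u x) x := (hu.differentiable (by norm_num) x).hasFDerivAt
    have ht := hasF_t j hx0
    have hq := ((hs x hx).2.differentiableAt (by norm_num)).hasDerivAt.comp_hasFDerivAt x ht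
    have hr := hasF_norm hx0
    have hinv : HasDerivAt (fun r : ℝ => (r ^ 2)⁻¹) (-2 * (‖x‖ ^ 3)⁻¹) ‖x‖ := by
      refine ((hasDerivAt_pow 2 ‖x‖).inv (by positivity)).congr_deriv ?_
      field_simp
      simp
      ring
    have d1 := hud.mul (hud.mul ((hq.mul ht).const_add k |>.mul (hinv.comp_hasFDerivAt x hr)))
    have d2 := hud.mul (hud.mul (hq.mul ((hasDerivAt_inv hn.ne').comp_hasFDerivAt x hr)))
    have hxx : inner ℝ x x = ‖x‖ ^ 2 := real_inner_self_eq_norm_sq x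
    have hxe : inner ℝ x (EuclideanSpace.single j (1:ℝ)) = x j := by
      simp [EuclideanSpace.inner_single_right]
    have f1 : fderiv ℝ (fun x => u x * w₁ x) x x =
        2 * u x * fderiv ℝ u x x * ((k + q (x j / ‖x‖) * (x j / ‖x‖)) / ‖x‖ ^ 2)
        - 2 * u x ^ 2 * ((k + q (x j / ‖x‖) * (x j / ‖x‖)) / ‖x‖ ^ 2) := by
      refine (congrArg (fun L => L x) d1.fderiv).trans ?_
      simp
      generalize q (x j / ‖x‖) = Q
      generalize deriv q (x j / ‖x‖) = Q'
      generalize fderiv ℝ u x x = U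
      field_simp
      ring
    have f2 : fderiv ℝ (fun x => u x * w₂ x) x (EuclideanSpace.single j (1:ℝ)) =
        2 * u x * fderiv ℝ u x (EuclideanSpace.single j (1:ℝ)) * (q (x j / ‖x‖) / ‖x‖)
        + u x ^ 2 * (deriv q (x j / ‖x‖) * (1 - (x j / ‖x‖) ^ 2) -
            q (x j / ‖x‖) * (x j / ‖x‖)) / ‖x‖ ^ 2 := by
      refine (congrArg (fun L => L (EuclideanSpace.single j (1:ℝ))) d2.fderiv).trans ?_
      simp [hxe]
      generalize q (x j / ‖x‖) = Q
      generalize deriv q (x j / ‖x‖) = Q'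
      generalize fderiv ℝ u x (EuclideanSpace.single j (1:ℝ)) = U
      field_simp
      ring
    have hix : inner ℝ (gradient u x) x = fderiv ℝ u x x := by
      simp [gradient]
    have hij : (gradient u x) j = fderiv ℝ u x (EuclideanSpace.single j (1:ℝ)) := by
      have : inner ℝ (gradient u x) (EuclideanSpace.single j (1:ℝ)) =
        fderiv ℝ u x (EuclideanSpace.single j (1:ℝ)) := by simp [gradient]
      rw [← this, EuclideanSpace.inner_single_right]; simp
    beta_reduce
    rw [f1, f2, Fv, norm_comb, hix, hij, Vp]
    simp only [hw₁]
    generalize q (x j / ‖x‖) = Q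
    generalize deriv q (x j / ‖x‖) = Q'
    generalize fderiv ℝ u x (EuclideanSpace.single j (1:ℝ)) = U
    generalize fderiv ℝ u x x = U₂
    have hNk : (N:ℝ) = 2 * k + 2 := by linarith
    rw [hNk]
    field_simp
    ring
  · have hu0 : u x = 0 := image_eq_zero_of_notMem_tsupport hx
    have hz1 : fderiv ℝ (fun x => u x * w₁ x) x = 0 := by
      have : x ∉ tsupport (fun x => u x * w₁ x) := fun h => hx (tsupport_mul_subset_left h)
      exact image_eq_zero_of_notMem_tsupport fun h => this (tsupport_fderiv_subset ℝ h)
    have hz2 : fderiv ℝ (fun x => u x * w₂ x) x = 0 := by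
      have : x ∉ tsupport (fun x => u x * w₂ x) := fun h => hx (tsupport_mul_subset_left h)
      exact image_eq_zero_of_notMem_tsupport fun h => this (tsupport_fderiv_subset ℝ h)
    beta_reduce
    rw [hz1, hz2]
    simp [hu0]

lemma abs_t_le {N : ℕ} (j : Fin N) (x : EuclideanSpace ℝ (Fin N)) : |x j / ‖x‖| ≤ 1 := by
  rw [abs_div, abs_of_nonneg (norm_nonneg x)]
  exact div_le_one_of_le₀ (PiLp.norm_apply_le x j) (norm_nonneg x)

lemma integrable_hardy {N : ℕ} {u : EuclideanSpace ℝ (Fin N) → ℝ} (hu : ContDiff ℝ 1 u)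
    (hc : HasCompactSupport u) (hs : ∀ x ∈ tsupport u, x ≠ 0) :
    Continuous (fun x => u x ^ 2 / ‖x‖ ^ 2) ∧ HasCompactSupport (fun x => u x ^ 2 / ‖x‖ ^ 2) := by
  have he : (fun x => u x ^ 2 / ‖x‖ ^ 2) = fun x => u x * (u x * (‖x‖ ^ 2)⁻¹) := by
    ext x; rw [div_eq_mul_inv]; ring
  rw [he]
  refine ⟨ContDiff.continuous (𝕜 := ℝ) (n := 1) (contDiff_mul_supp hu fun x hx => ?_), hc.mul_right⟩
  have hx0 := hs x hx
  have hn : ‖x‖ ≠ 0 := (norm_pos_iff.2 hx0).ne'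
  exact hu.contDiffAt.mul (((contDiffAt_norm ℝ hx0).pow 2).inv (by positivity))

lemma integrable_grad {N : ℕ} {u : EuclideanSpace ℝ (Fin N) → ℝ} (hu : ContDiff ℝ 1 u)
    (hc : HasCompactSupport u) :
    Integrable (fun x => ‖gradient u x‖ ^ 2) := by
  have he : (fun x => ‖gradient u x‖ ^ 2) = fun x => ‖fderiv ℝ u x‖ ^ 2 := by
    ext x; simp [gradient]
  rw [he]
  apply Continuous.integrable_of_hasCompactSupport
  · exact (hu.continuous_fderiv (by norm_num)).norm.pow 2
  · exact (hc.fderiv ℝ).comp_left (g := fun L => ‖L‖ ^ 2) (by simp)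

lemma lower {N : ℕ} (hN : 3 ≤ N) (j : Fin N) {κ : ℝ} (hκ : 0 < κ) : ∃ η : ℝ, 0 < η ∧
    ∀ u : EuclideanSpace ℝ (Fin N) → ℝ, ContDiff ℝ 1 u → HasCompactSupport u →
    (∀ x ∈ tsupport u, x ≠ 0 ∧ -η * ‖x‖ ≤ x j) →
    ((N:ℝ) ^ 2 / 4 - κ) * ∫ x, u x ^ 2 / ‖x‖ ^ 2 ≤ ∫ x, ‖gradient u x‖ ^ 2 := by
  have hN' : (3:ℝ) ≤ N := by exact_mod_cast hN
  obtain ⟨η, hη⟩ : ∃ η : ℝ, η = κ / ((N - 1) * (N + 1 + κ)) := ⟨_, rfl⟩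
  obtain ⟨a, ha⟩ : ∃ a : ℝ, a = η * (N - 1) := ⟨_, rfl⟩
  have hd : 0 < ((N:ℝ) - 1) * (N + 1 + κ) := mul_pos (by linarith) (by linarith)
  have hη0 : 0 < η := by rw [hη]; positivity
  have haκ : a * (N + 1 + κ) = κ := by
    rw [ha, hη]
    have h1 : (N:ℝ) - 1 ≠ 0 := by linarith
    have h2 : (N:ℝ) + 1 + κ ≠ 0 := by linarith
    field_simp
  have ha0 : 0 < a := by rw [ha]; exact mul_pos hη0 (by linarith)
  have ha1 : a < 1 := by
    by_contra h
    push Not at h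
    nlinarith
  have hη1 : 2 * η < 1 := by nlinarith
  have hfpos : ∀ t : ℝ, -η ≤ t → t ≤ 1 → 0 < t + 2 * η - a * t ^ 2 ∧ 0 ≤ t + 2 * η - t ^ 2 := by
    intro t h1 h2
    have : 0 ≤ t + 2 * η - t ^ 2 ∧ 0 < t + 2 * η := by
      refine ⟨?_, by linarith⟩
      rcases le_or_gt 0 t with h | h
      · nlinarith
      · nlinarith
    refine ⟨?_, this.1⟩
    nlinarith [this.1, this.2, mul_nonneg ha0.le this.1]
  refine ⟨η, hη0, fun u hu hc hs => ?_⟩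
  set q : ℝ → ℝ := fun t => (1 - 2 * a * t) / (t + 2 * η - a * t ^ 2) with hq
  have htr : ∀ x ∈ tsupport u, -η ≤ x j / ‖x‖ ∧ x j / ‖x‖ ≤ 1 := by
    intro x hx
    have hn : 0 < ‖x‖ := norm_pos_iff.2 (hs x hx).1
    exact ⟨by rw [le_div_iff₀ hn]; exact (hs x hx).2, (abs_le.1 (abs_t_le j x)).2⟩
  obtain ⟨R, hR, hR0, hRx⟩ := key j (((N:ℝ) - 2) / 2) (by ring) q hu hc (fun x hx => by
    refine ⟨(hs x hx).1, ?_⟩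
    have hp := (hfpos _ (htr x hx).1 (htr x hx).2).1.ne'
    exact ContDiffAt.div (by fun_prop) (by fun_prop) hp)
  have hh := integrable_hardy hu hc (fun x hx => (hs x hx).1)
  have hhi := hh.1.integrable_of_hasCompactSupport (μ := volume) hh.2
  have hpt : ∀ x, ((N:ℝ) ^ 2 / 4 - κ) * (u x ^ 2 / ‖x‖ ^ 2) + R x ≤ ‖gradient u x‖ ^ 2 := by
    intro x
    rw [hRx x]
    suffices h : ((N:ℝ) ^ 2 / 4 - κ) * (u x ^ 2 / ‖x‖ ^ 2) ≤
        u x ^ 2 / ‖x‖ ^ 2 * Vp N (((N:ℝ) - 2) / 2) q (x j / ‖x‖) by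
      nlinarith [sq_nonneg ‖gradient u x + u x • Fv j (((N:ℝ) - 2) / 2) q x‖]
    by_cases hx : x ∈ tsupport u
    · rw [mul_comm]
      apply mul_le_mul_of_nonneg_left _ (by positivity)
      obtain ⟨h1, h2⟩ := htr x hx
      generalize x j / ‖x‖ = t at h1 h2
      obtain ⟨hf, hg⟩ := hfpos t h1 h2
      have hder : HasDerivAt q (((-(2 * a)) * (t + 2 * η - a * t ^ 2) -
          (1 - 2 * a * t) * (1 - 2 * a * t)) / (t + 2 * η - a * t ^ 2) ^ 2) t := by
        have e1 : HasDerivAt (fun t : ℝ => 1 - 2 * a * t) (-(2 * a)) t := by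
          simpa using ((hasDerivAt_id t).const_mul (2 * a)).const_sub 1
        have e2 : HasDerivAt (fun t : ℝ => t + 2 * η - a * t ^ 2) (1 - 2 * a * t) t := by
          refine (((hasDerivAt_id t).add_const (2 * η)).sub
            ((hasDerivAt_pow 2 t).const_mul a)).congr_deriv ?_
          simp; ring
        exact e1.div e2 hf.ne'
      rw [Vp, hder.deriv]
      have : (((N:ℝ) - 2) / 2) ^ 2 + (N - 1) * (q t * t) -
          (1 - t ^ 2) * (((-(2 * a)) * (t + 2 * η - a * t ^ 2) -
          (1 - 2 * a * t) * (1 - 2 * a * t)) / (t + 2 * η - a * t ^ 2) ^ 2 + q t ^ 2)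
          = (N:ℝ) ^ 2 / 4 - κ + κ * (t + 2 * η - t ^ 2) / (t + 2 * η - a * t ^ 2) := by
        have h3 : (((N:ℝ) - 2) / 2) ^ 2 + (N - 1) * (q t * t) -
          (1 - t ^ 2) * (((-(2 * a)) * (t + 2 * η - a * t ^ 2) -
          (1 - 2 * a * t) * (1 - 2 * a * t)) / (t + 2 * η - a * t ^ 2) ^ 2 + q t ^ 2)
          = (((N:ℝ) - 2) / 2) ^ 2 + ((N - 1) * (1 - 2 * a * t) * t + 2 * a * (1 - t ^ 2)) /
            (t + 2 * η - a * t ^ 2) := by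
          simp only [hq]
          field_simp
          ring
        rw [h3]
        have h4 : (N - 1) * (1 - 2 * a * t) * t + 2 * a * (1 - t ^ 2) =
          (N - 1 - κ) * (t + 2 * η - a * t ^ 2) + κ * (t + 2 * η - t ^ 2) := by
          linear_combination (-t ^ 2) * haκ + 2 * ha
        rw [h4, add_div, mul_div_cancel_right₀ _ hf.ne']
        ring
      rw [this]
      have : 0 ≤ κ * (t + 2 * η - t ^ 2) / (t + 2 * η - a * t ^ 2) := by positivity
      linarith
    · simp [image_eq_zero_of_notMem_tsupport hx]
  calc ((N:ℝ) ^ 2 / 4 - κ) * ∫ x, u x ^ 2 / ‖x‖ ^ 2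
      = ∫ x, (((N:ℝ) ^ 2 / 4 - κ) * (u x ^ 2 / ‖x‖ ^ 2) + R x) := by
        rw [integral_add (hhi.const_mul _) hR, hR0, integral_const_mul, add_zero]
    _ ≤ _ := integral_mono ((hhi.const_mul _).add hR) (integrable_grad hu hc) hpt

lemma sep {N : ℕ} (j : Fin N) {n : WithTop ℕ∞} {A C : ℝ → ℝ}
    (hA : ContDiff ℝ n A) (hC : ContDiff ℝ n C)
    {L : ℝ} (hL : ∀ s, L < |s| → A s = 0) (hC0 : C 0 = 0) :
    ContDiff ℝ n (fun x : EuclideanSpace ℝ (Fin N) => A (log ‖x‖) * C (x j / ‖x‖)) ∧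
    HasCompactSupport (fun x : EuclideanSpace ℝ (Fin N) => A (log ‖x‖) * C (x j / ‖x‖)) := by
  have hsmall : ∀ x : EuclideanSpace ℝ (Fin N), ‖x‖ < exp (-L) →
      A (log ‖x‖) * C (x j / ‖x‖) = 0 := by
    intro x hx
    by_cases h0 : x = 0
    · simp [h0, hC0]
    · have hp : 0 < ‖x‖ := norm_pos_iff.2 h0
      have : log ‖x‖ < -L := by rwa [Real.log_lt_iff_lt_exp hp]
      rw [hL _ (lt_of_lt_of_le (by linarith) (neg_le_abs _)), zero_mul]
  constructor
  · rw [contDiff_iff_contDiffAt]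
    intro x
    by_cases h0 : x = 0
    · have : (fun x : EuclideanSpace ℝ (Fin N) => A (log ‖x‖) * C (x j / ‖x‖))
          =ᶠ[nhds x] fun _ => 0 := by
        have : Metric.ball x (exp (-L)) ∈ nhds x := Metric.ball_mem_nhds _ (exp_pos _)
        filter_upwards [this] with y hy
        apply hsmall
        simpa [h0] using hy
      exact contDiffAt_const.congr_of_eventuallyEq this
    · have hp : ‖x‖ ≠ 0 := (norm_pos_iff.2 h0).ne'
      exact (hA.contDiffAt.comp x ((contDiffAt_norm ℝ h0).log hp)).mul
        (hC.contDiffAt.comp x (contDiffAt_t j h0))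
  · apply HasCompactSupport.of_support_subset_isCompact (isCompact_closedBall 0 (exp L))
    intro x hx
    by_contra h
    apply hx
    have h' : exp L < ‖x‖ := by simpa using h
    have : L < log ‖x‖ := by rwa [Real.lt_log_iff_exp_lt ((exp_pos _).trans h')]
    simp only
    rw [hL _ (this.trans_le (le_abs_self _)), zero_mul]

lemma sep_tsupport {N : ℕ} (j : Fin N) {A C : ℝ → ℝ}
    {L h : ℝ} (hL : ∀ s, L < |s| → A s = 0) (hh : 0 < h) (hC : ∀ t ≤ h, C t = 0) :
    ∀ x ∈ tsupport (fun x : EuclideanSpace ℝ (Fin N) => A (log ‖x‖) * C (x j / ‖x‖)),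
      0 < ‖x‖ ∧ h * ‖x‖ ≤ x j := by
  have hcl : IsClosed {x : EuclideanSpace ℝ (Fin N) | exp (-L) ≤ ‖x‖ ∧ h * ‖x‖ ≤ x j} := by
    have h1 : IsClosed {x : EuclideanSpace ℝ (Fin N) | exp (-L) ≤ ‖x‖} :=
      isClosed_le (by fun_prop) (by fun_prop)
    have h2 : IsClosed {x : EuclideanSpace ℝ (Fin N) | h * ‖x‖ ≤ x j} :=
      isClosed_le (by fun_prop) (by fun_prop)
    exact h1.inter h2
  intro x hx
  have : x ∈ {x : EuclideanSpace ℝ (Fin N) | exp (-L) ≤ ‖x‖ ∧ h * ‖x‖ ≤ x j} := by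
    refine closure_minimal ?_ hcl hx
    intro y hy
    have hy1 : A (log ‖y‖) ≠ 0 := left_ne_zero_of_mul hy
    have hy2 : C (y j / ‖y‖) ≠ 0 := right_ne_zero_of_mul hy
    have hy0 : y ≠ 0 := by
      rintro rfl
      apply hy2
      apply hC
      simpa using hh.le
    have hp : 0 < ‖y‖ := norm_pos_iff.2 hy0
    constructor
    · by_contra hlt
      push Not at hlt
      have : log ‖y‖ < -L := by rwa [Real.log_lt_iff_lt_exp hp]
      exact hy1 (hL _ (lt_of_lt_of_le (by linarith) (neg_le_abs _)))
    · by_contra hlt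
      push Not at hlt
      apply hy2
      apply hC
      rw [div_le_iff₀ hp]
      exact hlt.le
  exact ⟨(exp_pos _).trans_le this.1, this.2⟩

lemma hasF_log {N : ℕ} {x : EuclideanSpace ℝ (Fin N)} (hx : x ≠ 0) :
    HasFDerivAt (fun y : EuclideanSpace ℝ (Fin N) => log ‖y‖) ((‖x‖ ^ 2)⁻¹ • innerSL ℝ x) x := by
  have hp : ‖x‖ ≠ 0 := (norm_pos_iff.2 hx).ne'
  refine ((hasF_norm hx).log hp).congr_fderiv ?_
  ext v
  simp
  field_simp

lemma grad_sep {N : ℕ} (j : Fin N) {A C : ℝ → ℝ} {a' c' : ℝ} {x : EuclideanSpace ℝ (Fin N)}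
    (hx : x ≠ 0) (hA : HasDerivAt A a' (log ‖x‖)) (hC : HasDerivAt C c' (x j / ‖x‖)) :
    gradient (fun x : EuclideanSpace ℝ (Fin N) => A (log ‖x‖) * C (x j / ‖x‖)) x =
      ((a' * C (x j / ‖x‖) - A (log ‖x‖) * c' * (x j / ‖x‖)) / ‖x‖ ^ 2) • x +
      (A (log ‖x‖) * c' / ‖x‖) • EuclideanSpace.single j (1:ℝ) := by
  apply HasGradientAt.gradient
  rw [hasGradientAt_iff_hasFDerivAt]
  have hp : ‖x‖ ≠ 0 := (norm_pos_iff.2 hx).ne'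
  refine ((hA.comp_hasFDerivAt x (hasF_log hx)).mul
    (hC.comp_hasFDerivAt x (hasF_t j hx))).congr_fderiv ?_
  ext v
  simp [inner_add_left, inner_smul_left, EuclideanSpace.inner_single_left]
  field_simp
  ring

lemma test_identity {N : ℕ} (hN : 3 ≤ N) (j : Fin N) {A B : ℝ → ℝ}
    (hA : ContDiff ℝ (⊤ : ℕ∞) A) (hB : ContDiff ℝ (⊤ : ℕ∞) B) {L h : ℝ}
    (hL : ∀ s, L < |s| → A s = 0) (hh : 0 < h) (hBh : ∀ t ≤ h, B t = 0) :
    ∃ u : EuclideanSpace ℝ (Fin N) → ℝ, ContDiff ℝ (⊤ : ℕ∞) u ∧ HasCompactSupport u ∧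
      (∀ x ∈ tsupport u, 0 < ‖x‖ ∧ h * ‖x‖ ≤ x j) ∧
      ((∫ x, u x ^ 2 / ‖x‖ ^ 2) = (∫ s, A s ^ 2) *
        ∫ w, ((w : EuclideanSpace ℝ (Fin N)) j) ^ 2 * B ((w : EuclideanSpace ℝ (Fin N)) j) ^ 2
        ∂((volume : Measure (EuclideanSpace ℝ (Fin N))).toSphere)) ∧
      (∫ x, ‖gradient u x‖ ^ 2) = (N:ℝ) ^ 2 / 4 * (∫ x, u x ^ 2 / ‖x‖ ^ 2) +
       ((∫ s, deriv A s ^ 2) *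
        ∫ w, ((w : EuclideanSpace ℝ (Fin N)) j) ^ 2 * B ((w : EuclideanSpace ℝ (Fin N)) j) ^ 2
        ∂((volume : Measure (EuclideanSpace ℝ (Fin N))).toSphere)) +
       ((∫ s, A s ^ 2) *
        ∫ w, ((w : EuclideanSpace ℝ (Fin N)) j) ^ 2 * deriv B ((w : EuclideanSpace ℝ (Fin N)) j) ^ 2
          * (1 - ((w : EuclideanSpace ℝ (Fin N)) j) ^ 2)
        ∂((volume : Measure (EuclideanSpace ℝ (Fin N))).toSphere)) := by
  have hN' : (3:ℝ) ≤ N := by exact_mod_cast hN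
  obtain ⟨k, hk⟩ : ∃ k : ℝ, 2 * k = N - 2 := ⟨((N:ℝ) - 2) / 2, by ring⟩
  have hAd : ∀ s, HasDerivAt A (deriv A s) s := fun s =>
    (hA.differentiable (by simp) s).hasDerivAt
  have hBd : ∀ s, HasDerivAt B (deriv B s) s := fun s =>
    (hB.differentiable (by simp) s).hasDerivAt
  set a : ℝ → ℝ := fun s => exp (-k * s) * A s with ha
  set C : ℝ → ℝ := fun t => t * B t with hC
  have had : ∀ s, HasDerivAt a (exp (-k * s) * (deriv A s - k * A s)) s := by
    intro s
    have e : HasDerivAt (fun s => exp (-k * s)) (exp (-k * s) * (-k)) s := by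
      simpa using ((hasDerivAt_id s).const_mul (-k)).exp
    refine (e.mul (hAd s)).congr_deriv ?_
    ring
  have hCd : ∀ t, HasDerivAt C (B t + t * deriv B t) t := by
    intro t
    refine ((hasDerivAt_id t).mul (hBd t)).congr_deriv ?_
    simp
  have hac : ContDiff ℝ (⊤ : ℕ∞) a := by fun_prop
  have hCc : ContDiff ℝ (⊤ : ℕ∞) C := by fun_prop
  have haL : ∀ s, L < |s| → a s = 0 := fun s hs => by simp [ha, hL s hs]
  have hCh : ∀ t ≤ h, C t = 0 := fun t ht => by simp [hC, hBh t ht]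
  obtain ⟨hu, huc⟩ := sep j hac hCc haL (hCh 0 hh.le)
  have hts := sep_tsupport (N := N) j haL hh hCh
  set u : EuclideanSpace ℝ (Fin N) → ℝ := fun x => a (log ‖x‖) * C (x j / ‖x‖) with hudef
  have hexp : ∀ x : EuclideanSpace ℝ (Fin N), x ≠ 0 →
      exp (-k * log ‖x‖) ^ 2 / ‖x‖ ^ 2 = exp (-(N:ℝ) * log ‖x‖) := by
    intro x hx
    have hp : 0 < ‖x‖ := norm_pos_iff.2 hx
    have : ‖x‖ ^ 2 = exp (2 * log ‖x‖) := by
      rw [show (2:ℝ) * log ‖x‖ = log ‖x‖ + log ‖x‖ by ring, exp_add, exp_log hp, sq]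
    rw [this, ← Real.exp_nat_mul, ← Real.exp_sub]
    congr 1
    push_cast
    linear_combination (-log ‖x‖) * hk
  have hne : Nonempty (Fin N) := ⟨j⟩
  have hae : ∀ᵐ x : EuclideanSpace ℝ (Fin N), x ≠ 0 := by
    rw [ae_iff]; simp
  refine ⟨u, hu, huc, hts, ?_, ?_⟩
  · rw [← polar hN j (fun s => A s ^ 2) (fun t => t ^ 2 * B t ^ 2)]
    apply integral_congr_ae
    filter_upwards [hae] with x hx
    rw [← hexp x hx]
    simp only [hudef, ha, hC]
    ring
  · have hu1 : ContDiff ℝ 1 u := hu.of_le (by simp)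
    have htpos : ∀ x ∈ tsupport u, 0 < x j / ‖x‖ := fun x hx => by
      obtain ⟨h1, h2⟩ := hts x hx
      exact div_pos (lt_of_lt_of_le (mul_pos hh h1) h2) h1
    obtain ⟨R, hR, hR0, hRx⟩ := key j k hk (fun t => t⁻¹) hu1 huc (fun x hx =>
      ⟨norm_pos_iff.1 (hts x hx).1, contDiffAt_inv ℝ (htpos x hx).ne'⟩)
    have hV : ∀ x, u x ^ 2 / ‖x‖ ^ 2 * Vp N k (fun t => t⁻¹) (x j / ‖x‖) =
        (N:ℝ) ^ 2 / 4 * (u x ^ 2 / ‖x‖ ^ 2) := by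
      intro x
      by_cases hx : x ∈ tsupport u
      · have ht := (htpos x hx).ne'
        have : Vp N k (fun t => t⁻¹) (x j / ‖x‖) = (N:ℝ) ^ 2 / 4 := by
          have hk2 : k = ((N:ℝ) - 2) / 2 := by linarith
          rw [Vp, deriv_inv, hk2]
          generalize x j / ‖x‖ = t at ht
          field_simp
          ring
        rw [this]; ring
      · rw [image_eq_zero_of_notMem_tsupport hx]; simp
    have hG : ∀ x, x ≠ 0 → ‖gradient u x + u x • Fv j k (fun t => t⁻¹) x‖ ^ 2 =
        exp (-(N:ℝ) * log ‖x‖) * (deriv A (log ‖x‖) ^ 2) *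
          ((x j / ‖x‖) ^ 2 * B (x j / ‖x‖) ^ 2) +
        exp (-(N:ℝ) * log ‖x‖) * (A (log ‖x‖) ^ 2) *
          ((x j / ‖x‖) ^ 2 * deriv B (x j / ‖x‖) ^ 2 * (1 - (x j / ‖x‖) ^ 2)) := by
      intro x hx
      have hp : ‖x‖ ≠ 0 := (norm_pos_iff.2 hx).ne'
      rw [← hexp x hx, hudef, grad_sep j hx (had _) (hCd _)]
      simp only [ha, hC, Fv]
      have hxj : x j = (x j / ‖x‖) * ‖x‖ := by field_simp
      generalize ht : x j / ‖x‖ = t at hxj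
      generalize exp (-k * log ‖x‖) = E
      generalize deriv A (log ‖x‖) = A'
      generalize A (log ‖x‖) = A0
      by_cases ht0 : t = 0
      · subst ht0
        simp [hBh 0 hh.le]
      generalize deriv B t = B'
      generalize B t = B0
      have hv := norm_comb j 0 x 1
        (E * (A' * t * B0 - A0 * t ^ 2 * B') / ‖x‖ ^ 2) (- (E * A0 * t * B' / ‖x‖))
      rw [hxj] at hv
      simp only [norm_zero, inner_zero_left, zero_add, one_smul] at hv
      refine Eq.trans (congrArg (fun v => ‖v‖ ^ 2) ?_) (hv.trans ?_)
      · ext i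
        by_cases hij : i = j
        · simp [hij]
          field_simp
          ring
        · simp [hij]
          field_simp
          ring
      · simp
        field_simp
        ring
    have hi : ∀ F G : ℝ → ℝ, Continuous F → Continuous G → (∀ s, L < |s| → F s = 0) →
        G 0 = 0 → Integrable (fun x : EuclideanSpace ℝ (Fin N) =>
          exp (-(N:ℝ) * log ‖x‖) * F (log ‖x‖) * G (x j / ‖x‖)) := by
      intro F G hF hG' hFL hG0
      obtain ⟨h1, h2⟩ := sep (N := N) (n := 0) j
        (A := fun s => exp (-(N:ℝ) * s) * F s) (C := G)
        (contDiff_zero.2 (by fun_prop)) (contDiff_zero.2 hG') (L := L)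
        (fun s hs => by simp [hFL s hs]) hG0
      exact h1.continuous.integrable_of_hasCompactSupport h2
    have hA' : Continuous (deriv A) := hA.continuous_deriv (by simp)
    have hB' : Continuous (deriv B) := hB.continuous_deriv (by simp)
    have hdL : ∀ s, L < |s| → deriv A s = 0 := by
      intro s hs
      have : A =ᶠ[nhds s] fun _ => 0 := by
        have ho : IsOpen {s : ℝ | L < |s|} := isOpen_lt (by fun_prop) (by fun_prop)
        filter_upwards [ho.mem_nhds hs] with y hy using hL y hy
      rw [this.deriv_eq]; simp
    have hh1 := integrable_hardy hu1 huc (fun x hx => norm_pos_iff.1 (hts x hx).1)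
    have hhi := hh1.1.integrable_of_hasCompactSupport (μ := volume) hh1.2
    have i1 := hi (fun s => deriv A s ^ 2) (fun t => t ^ 2 * B t ^ 2) (by fun_prop)
      (by have := hB.continuous; fun_prop) (fun s hs => by simp [hdL s hs]) (by simp)
    have i2 := hi (fun s => A s ^ 2) (fun t => t ^ 2 * deriv B t ^ 2 * (1 - t ^ 2))
      (by have := hA.continuous; fun_prop) (by fun_prop) (fun s hs => by simp [hL s hs]) (by simp)
    have e1 := polar hN j (fun s => deriv A s ^ 2) (fun t => t ^ 2 * B t ^ 2)
    have e2 := polar hN j (fun s => A s ^ 2) (fun t => t ^ 2 * deriv B t ^ 2 * (1 - t ^ 2))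
    rw [← e1, ← e2, ← integral_const_mul]
    have f1 := integral_add (((hhi.const_mul ((N:ℝ) ^ 2 / 4)).add i1).add i2) hR
    have f2 := integral_add ((hhi.const_mul ((N:ℝ) ^ 2 / 4)).add i1) i2
    have f3 := integral_add (hhi.const_mul ((N:ℝ) ^ 2 / 4)) i1
    simp only [Pi.add_apply] at f1 f2 f3
    rw [hR0, add_zero] at f1
    rw [← f3, ← f2, ← f1]
    apply integral_congr_ae
    filter_upwards [hae] with x hx
    rw [hRx x, hG x hx, hV x]
    ring

lemma radial {ε : ℝ} (hε : 0 < ε) : ∃ (A : ℝ → ℝ) (L : ℝ), ContDiff ℝ (⊤ : ℕ∞) A ∧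
    (∀ s, L < |s| → A s = 0) ∧ 0 < ∫ s, A s ^ 2 ∧ ∫ s, deriv A s ^ 2 ≤ ε * ∫ s, A s ^ 2 := by
  obtain ⟨f, hf⟩ : ∃ f : ContDiffBump (0:ℝ), f.rIn = 1 ∧ f.rOut = 2 :=
    ⟨⟨1, 2, by norm_num, by norm_num⟩, rfl, rfl⟩
  have hpos : 0 < ∫ s, f s ^ 2 := by
    apply Continuous.integral_pos_of_hasCompactSupport_nonneg_nonzero (x := (0:ℝ))
    · exact f.continuous.pow 2
    · exact f.hasCompactSupport.comp_left (g := fun y => y ^ 2) (by simp)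
    · intro s; positivity
    · have : f 0 = 1 := f.one_of_mem_closedBall (by simp [f.rIn_pos.le])
      simp [this]
  have hD : 0 ≤ ∫ s, deriv f s ^ 2 := integral_nonneg fun s => by positivity
  obtain ⟨K, hK1, hK⟩ : ∃ K : ℝ, 1 ≤ K ∧ (∫ s, deriv f s ^ 2) ≤ ε * K * ∫ s, f s ^ 2 := by
    refine ⟨1 + (∫ s, deriv f s ^ 2) / (ε * ∫ s, f s ^ 2), ?_, ?_⟩
    · have : 0 ≤ (∫ s, deriv f s ^ 2) / (ε * ∫ s, f s ^ 2) := by positivity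
      linarith
    · generalize (∫ s, deriv f s ^ 2) = D at *
      generalize (∫ s, f s ^ 2) = I at *
      have : ε * (1 + D / (ε * I)) * I = ε * I + D := by field_simp
      rw [this]
      have := mul_pos hε hpos
      linarith
  have hK0 : 0 < K := by linarith
  have hd : ∀ s, deriv (fun s => f (s / K)) s = deriv f (s / K) / K := by
    intro s
    have h1 : HasDerivAt f (deriv f (s / K)) (s / K) :=
      ((f.contDiff (n := 1)).differentiable (by simp) _).hasDerivAt
    have := h1.comp s ((hasDerivAt_id s).div_const K)
    rw [show (fun s => f (s / K)) = f ∘ (fun s => id s / K) from rfl, this.deriv]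
    ring
  have i1 : ∫ s, f (s / K) ^ 2 = K * ∫ s, f s ^ 2 := by
    rw [Measure.integral_comp_div (fun s => f s ^ 2) K, abs_of_pos hK0, smul_eq_mul]
  have i2 : ∫ s, (deriv f (s / K) / K) ^ 2 = K⁻¹ * ∫ s, deriv f s ^ 2 := by
    rw [Measure.integral_comp_div (fun s => (deriv f s / K) ^ 2) K, abs_of_pos hK0, smul_eq_mul]
    simp only [div_pow, integral_div]
    field_simp
  refine ⟨fun s => f (s / K), 2 * K, ?_, ?_, ?_, ?_⟩
  · exact f.contDiff.comp (contDiff_id.div_const K)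
  · intro s hs
    apply f.zero_of_le_dist
    rw [hf.2, Real.dist_eq, sub_zero, abs_div, abs_of_pos hK0, le_div_iff₀ hK0]
    exact hs.le
  · simp only
    rw [i1]; positivity
  · simp only [hd]
    rw [i1, i2, inv_mul_le_iff₀ hK0]
    nlinarith [mul_pos (mul_pos hε hK0) hpos]

lemma angular {N : ℕ} (j : Fin N) {ε : ℝ} (hε : 0 < ε) : ∃ (B : ℝ → ℝ) (h : ℝ),
    ContDiff ℝ (⊤ : ℕ∞) B ∧ 0 < h ∧ (∀ t ≤ h, B t = 0) ∧
    0 < (∫ w, ((w : EuclideanSpace ℝ (Fin N)) j) ^ 2 * B ((w : EuclideanSpace ℝ (Fin N)) j) ^ 2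
        ∂((volume : Measure (EuclideanSpace ℝ (Fin N))).toSphere)) ∧
    (∫ w, ((w : EuclideanSpace ℝ (Fin N)) j) ^ 2 * deriv B ((w : EuclideanSpace ℝ (Fin N)) j) ^ 2
          * (1 - ((w : EuclideanSpace ℝ (Fin N)) j) ^ 2)
        ∂((volume : Measure (EuclideanSpace ℝ (Fin N))).toSphere)) ≤
    ε * (∫ w, ((w : EuclideanSpace ℝ (Fin N)) j) ^ 2 * B ((w : EuclideanSpace ℝ (Fin N)) j) ^ 2
        ∂((volume : Measure (EuclideanSpace ℝ (Fin N))).toSphere)) := by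
  have hne : Nonempty (Fin N) := ⟨j⟩
  set μ := (volume : Measure (EuclideanSpace ℝ (Fin N))).toSphere with hμ
  set T : ℝ → ℝ := Real.smoothTransition with hT
  have hTc : ContDiff ℝ (⊤ : ℕ∞) T := Real.smoothTransition.contDiff
  have hTd : Continuous (deriv T) := hTc.continuous_deriv (by simp)
  have hT0 : ∀ y < 0, deriv T y = 0 := by
    intro y hy
    have : T =ᶠ[nhds y] fun _ => 0 := by
      filter_upwards [Iio_mem_nhds hy] with z hz
      exact Real.smoothTransition.zero_of_nonpos (le_of_lt hz)
    rw [this.deriv_eq]; simp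
  have hT1 : ∀ y, 1 < y → deriv T y = 0 := by
    intro y hy
    have : T =ᶠ[nhds y] fun _ => 1 := by
      filter_upwards [Ioi_mem_nhds hy] with z hz
      exact Real.smoothTransition.one_of_one_le (le_of_lt hz)
    rw [this.deriv_eq]; simp
  obtain ⟨M, hM⟩ : ∃ M, ∀ y, ‖y ^ 2 * deriv T (y - 1) ^ 2‖ ≤ M := by
    apply Continuous.bounded_above_of_compact_support (by fun_prop)
    apply HasCompactSupport.of_support_subset_isCompact (isCompact_Icc (a := (1:ℝ)) (b := 2))
    intro y hy
    have h1 : deriv T (y - 1) ≠ 0 := by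
      intro h; apply hy; simp [h]
    constructor
    · by_contra h; exact h1 (hT0 _ (by linarith))
    · by_contra h; exact h1 (hT1 _ (by linarith))
  have hco : Continuous fun w : Metric.sphere (0 : EuclideanSpace ℝ (Fin N)) 1 =>
      (w : EuclideanSpace ℝ (Fin N)) j := by fun_prop
  have hw1 : ∀ w : Metric.sphere (0 : EuclideanSpace ℝ (Fin N)) 1,
      ((w : EuclideanSpace ℝ (Fin N)) j) ^ 2 ≤ 1 := by
    intro w
    have := abs_t_le j (w : EuclideanSpace ℝ (Fin N))
    rw [norm_eq_of_mem_sphere, div_one] at this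
    exact (sq_le_one_iff_abs_le_one _).2 this
  set Bn : ℕ → ℝ → ℝ := fun n t => T (t * ((n:ℝ) + 1) - 1) with hBn
  have hBc : ∀ n, ContDiff ℝ (⊤ : ℕ∞) (Bn n) := fun n =>
    hTc.comp ((contDiff_id.mul contDiff_const).sub contDiff_const)
  have hBd : ∀ n t, deriv (Bn n) t = deriv T (t * ((n:ℝ) + 1) - 1) * ((n:ℝ) + 1) := by
    intro n t
    have h1 : HasDerivAt T (deriv T (t * ((n:ℝ) + 1) - 1)) (t * ((n:ℝ) + 1) - 1) :=
      (hTc.differentiable (by simp) _).hasDerivAt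
    have h2 : HasDerivAt (fun t : ℝ => t * ((n:ℝ) + 1) - 1) ((n:ℝ) + 1) t := by
      simpa using ((hasDerivAt_id t).mul_const ((n:ℝ) + 1)).sub_const 1
    exact (h1.comp t h2).deriv
  have hint : ∀ g : ℝ → ℝ, Continuous g → Integrable (fun w :
      Metric.sphere (0 : EuclideanSpace ℝ (Fin N)) 1 => g ((w : EuclideanSpace ℝ (Fin N)) j)) μ := by
    intro g hg
    exact (hg.comp hco).integrable_of_hasCompactSupport (HasCompactSupport.of_compactSpace _)
  set J : ℕ → ℝ := fun n => ∫ w, ((w : EuclideanSpace ℝ (Fin N)) j) ^ 2 *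
    Bn n ((w : EuclideanSpace ℝ (Fin N)) j) ^ 2 ∂μ with hJ
  have hJ3 : 0 < J 3 := by
    have e1 : ‖(EuclideanSpace.single j (1:ℝ) : EuclideanSpace ℝ (Fin N))‖ = 1 := by simp
    apply Continuous.integral_pos_of_hasCompactSupport_nonneg_nonzero
      (x := (⟨EuclideanSpace.single j (1:ℝ), by simp⟩ :
        Metric.sphere (0 : EuclideanSpace ℝ (Fin N)) 1))
    · have := (hBc 3).continuous
      fun_prop
    · exact HasCompactSupport.of_compactSpace _
    · intro w; positivity
    · have : T 3 = 1 := Real.smoothTransition.one_of_one_le (by norm_num)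
      simp [hBn]
      norm_num
      simp [this]
  have hJm : ∀ n, 3 ≤ n → J 3 ≤ J n := by
    intro n hn
    apply integral_mono
    · exact hint (fun t => t ^ 2 * Bn 3 t ^ 2) (by have := (hBc 3).continuous; fun_prop)
    · exact hint (fun t => t ^ 2 * Bn n t ^ 2) (by have := (hBc n).continuous; fun_prop)
    intro w
    simp only
    generalize (w : EuclideanSpace ℝ (Fin N)) j = t
    apply mul_le_mul_of_nonneg_left _ (sq_nonneg _)
    have hn' : (3:ℝ) ≤ n := by exact_mod_cast hn
    by_cases ht : 0 ≤ t
    · apply pow_le_pow_left₀ (Real.smoothTransition.nonneg _)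
      apply Real.smoothTransition.monotone
      push_cast
      nlinarith
    · have : Bn 3 t = 0 := Real.smoothTransition.zero_of_nonpos (by push_cast; linarith)
      rw [this, zero_pow two_ne_zero]
      exact sq_nonneg (Bn n t)
  have hlim : Filter.Tendsto (fun n => ∫ w, ((w : EuclideanSpace ℝ (Fin N)) j) ^ 2 *
      deriv (Bn n) ((w : EuclideanSpace ℝ (Fin N)) j) ^ 2
          * (1 - ((w : EuclideanSpace ℝ (Fin N)) j) ^ 2) ∂μ) Filter.atTop
      (nhds (∫ w : Metric.sphere (0 : EuclideanSpace ℝ (Fin N)) 1, (0:ℝ) ∂μ)) := by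
    have hform : ∀ n (t : ℝ), t ^ 2 * deriv (Bn n) t ^ 2 =
        (t * ((n:ℝ) + 1)) ^ 2 * deriv T (t * ((n:ℝ) + 1) - 1) ^ 2 := by
      intro n t; rw [hBd]; ring
    apply tendsto_integral_of_dominated_convergence (fun _ => M)
    · intro n
      have := (hBc n).continuous_deriv (by simp)
      exact (hint (fun t => t ^ 2 * deriv (Bn n) t ^ 2 * (1 - t ^ 2)) (by fun_prop)).1
    · exact integrable_const _
    · intro n
      filter_upwards with w
      rw [hform, norm_mul]
      have h2 : ‖1 - ((w : EuclideanSpace ℝ (Fin N)) j) ^ 2‖ ≤ 1 := by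
        rw [Real.norm_eq_abs, abs_le]
        have := hw1 w
        constructor <;> nlinarith [sq_nonneg ((w : EuclideanSpace ℝ (Fin N)) j)]
      calc _ ≤ M * 1 := mul_le_mul (hM _) h2 (norm_nonneg _) ((norm_nonneg _).trans (hM 0))
        _ = M := mul_one _
    · filter_upwards with w
      apply tendsto_const_nhds.congr'
      obtain ⟨n0, hn0⟩ := exists_nat_gt (2 / (w : EuclideanSpace ℝ (Fin N)) j)
      filter_upwards [Filter.eventually_ge_atTop n0] with n hn
      rw [hform]
      generalize (w : EuclideanSpace ℝ (Fin N)) j = t at *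
      have hn' : (n0:ℝ) ≤ n := by exact_mod_cast hn
      have : deriv T (t * ((n:ℝ) + 1) - 1) = 0 := by
        by_cases ht : 0 < t
        · apply hT1
          rw [div_lt_iff₀ ht] at hn0
          nlinarith
        · apply hT0
          have : t * ((n:ℝ) + 1) ≤ 0 := mul_nonpos_of_nonpos_of_nonneg (by linarith) (by positivity)
          linarith
      rw [this]; simp
  rw [integral_zero] at hlim
  obtain ⟨n, hn, hn3⟩ := ((hlim.eventually_le_const (mul_pos hε hJ3)).and
    (Filter.eventually_ge_atTop 3)).exists
  have hJn := hJm n hn3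
  refine ⟨Bn n, 1 / ((n:ℝ) + 1), hBc n, by positivity, ?_, hJ3.trans_le hJn, ?_⟩
  · intro t ht
    apply Real.smoothTransition.zero_of_nonpos
    rw [le_div_iff₀ (by positivity)] at ht
    linarith
  · exact hn.trans (mul_le_mul_of_nonneg_left hJn hε.le)

lemma upper {N : ℕ} (hN : 3 ≤ N) (j : Fin N) {ε : ℝ} (hε : 0 < ε) :
    ∃ h : ℝ, 0 < h ∧ ∃ u : EuclideanSpace ℝ (Fin N) → ℝ, ContDiff ℝ (⊤ : ℕ∞) u ∧
      HasCompactSupport u ∧ (∀ x ∈ tsupport u, 0 < ‖x‖ ∧ h * ‖x‖ ≤ x j) ∧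
      0 < (∫ x, u x ^ 2 / ‖x‖ ^ 2) ∧
      (∫ x, ‖gradient u x‖ ^ 2) ≤ ((N:ℝ) ^ 2 / 4 + ε) * (∫ x, u x ^ 2 / ‖x‖ ^ 2) := by
  obtain ⟨A, L, hA, hL, hA0, hA1⟩ := radial (half_pos hε)
  obtain ⟨B, h, hB, hh, hBh, hB0, hB1⟩ := angular j (half_pos hε)
  obtain ⟨u, hu, huc, hts, e1, e2⟩ := test_identity hN j hA hB hL hh hBh
  refine ⟨h, hh, u, hu, huc, hts, ?_, ?_⟩
  · rw [e1]; exact mul_pos hA0 hB0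
  · rw [e2, e1]
    nlinarith [mul_le_mul_of_nonneg_left hB1 hA0.le, mul_le_mul_of_nonneg_right hA1 hB0.le]

lemma lastCoord_eq {N : ℕ} (hN : 3 ≤ N) (x : EuclideanSpace ℝ (Fin N)) :
    lastCoord x = x ⟨N - 1, by omega⟩ := by
  unfold lastCoord
  rw [Finset.sum_eq_single (⟨N - 1, by omega⟩ : Fin N)]
  · rw [if_pos]
    simp only
    omega
  · intro b _ hb
    rw [if_neg]
    intro h
    apply hb
    ext
    simp only
    omega
  · simp

lemma cone_integrals {N : ℕ} {γ : ℝ} {u : EuclideanSpace ℝ (Fin N) → ℝ}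
    (hs : tsupport u ⊆ cone N γ) :
    (∫ x in cone N γ, (u x) ^ 2 / ‖x‖ ^ 2) = (∫ x, (u x) ^ 2 / ‖x‖ ^ 2) ∧
    (∫ x in cone N γ, ‖gradient u x‖ ^ 2) = ∫ x, ‖gradient u x‖ ^ 2 := by
  constructor
  · apply setIntegral_eq_integral_of_forall_compl_eq_zero
    intro x hx
    rw [image_eq_zero_of_notMem_tsupport fun h => hx (hs h)]
    simp
  · apply setIntegral_eq_integral_of_forall_compl_eq_zero
    intro x hx
    have h0 : x ∉ tsupport u := fun h => hx (hs h)
    have : fderiv ℝ u x = 0 := by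
      have h1 : u =ᶠ[nhds x] fun _ => 0 := notMem_tsupport_iff_eventuallyEq.1 h0
      rw [h1.fderiv_eq]; simp
    simp [gradient, this]

lemma two_sided {N : ℕ} (hN : 3 ≤ N) {ε : ℝ} (hε : 0 < ε) : ∃ δ : ℝ, 0 < δ ∧
    ∀ γ : ℝ, |Real.cos γ| < δ → |coneHardyConst N γ - (N : ℝ) ^ 2 / 4| ≤ ε := by
  obtain ⟨η, hη, hlow⟩ := lower hN ⟨N - 1, by omega⟩ hε
  obtain ⟨h, hh, u, hu, huc, hts, hpos, hle⟩ := upper hN ⟨N - 1, by omega⟩ hε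
  refine ⟨min η h, lt_min hη hh, fun γ hγ => ?_⟩
  obtain ⟨g1, g2⟩ := abs_lt.1 hγ
  have g3 : -η < Real.cos γ := by linarith [min_le_left η h]
  have g4 : Real.cos γ < h := lt_of_lt_of_le g2 (min_le_right _ _)
  unfold coneHardyConst
  have hs : tsupport u ⊆ cone N γ := by
    intro x hx
    obtain ⟨h1, h2⟩ := hts x hx
    refine ⟨h1, ?_⟩
    rw [lastCoord_eq hN]
    nlinarith
  obtain ⟨i1, i2⟩ := cone_integrals hs
  have hlb : ∀ ρ ∈ {ρ : ℝ | ∃ u : EuclideanSpace ℝ (Fin N) → ℝ,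
      ContDiff ℝ (⊤ : ℕ∞) u ∧ HasCompactSupport u ∧ tsupport u ⊆ cone N γ ∧
      0 < (∫ x in cone N γ, (u x) ^ 2 / ‖x‖ ^ 2) ∧
      ρ = (∫ x in cone N γ, ‖gradient u x‖ ^ 2) / ∫ x in cone N γ, (u x) ^ 2 / ‖x‖ ^ 2},
      (N:ℝ) ^ 2 / 4 - ε ≤ ρ := by
    rintro ρ ⟨v, hv, hvc, hvs, hvp, rfl⟩
    obtain ⟨k1, k2⟩ := cone_integrals hvs
    rw [k1] at hvp
    rw [k1, k2, le_div_iff₀ hvp]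
    apply hlow v (hv.of_le (by simp)) hvc
    intro x hx
    obtain ⟨h1, h2⟩ := hvs hx
    rw [lastCoord_eq hN] at h2
    refine ⟨norm_pos_iff.1 h1, ?_⟩
    nlinarith
  have hmem : (∫ x, ‖gradient u x‖ ^ 2) / (∫ x, (u x) ^ 2 / ‖x‖ ^ 2) ∈
      {ρ : ℝ | ∃ u : EuclideanSpace ℝ (Fin N) → ℝ,
      ContDiff ℝ (⊤ : ℕ∞) u ∧ HasCompactSupport u ∧ tsupport u ⊆ cone N γ ∧
      0 < (∫ x in cone N γ, (u x) ^ 2 / ‖x‖ ^ 2) ∧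
      ρ = (∫ x in cone N γ, ‖gradient u x‖ ^ 2) / ∫ x in cone N γ, (u x) ^ 2 / ‖x‖ ^ 2} :=
    ⟨u, hu, huc, hs, by rw [i1]; exact hpos, by rw [i1, i2]⟩
  have l1 := le_csInf ⟨_, hmem⟩ hlb
  have l2 := csInf_le ⟨_, hlb⟩ hmem
  have l3 : (∫ x, ‖gradient u x‖ ^ 2) / (∫ x, (u x) ^ 2 / ‖x‖ ^ 2) ≤ (N:ℝ) ^ 2 / 4 + ε := by
    rwa [div_le_iff₀ hpos]
  rw [abs_le]
  constructor <;> linarith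

theorem stmt11 (N : ℕ) (hN : 3 ≤ N) :
    coneHardyConst N (π / 2) = (N : ℝ) ^ 2 / 4 ∧
    ∀ ε : ℝ, 0 < ε → ∃ δ : ℝ, 0 < δ ∧
      ∀ γ ∈ Set.Ioo (0 : ℝ) π, |γ - π / 2| < δ →
        |coneHardyConst N γ - (N : ℝ) ^ 2 / 4| < ε := by
  refine ⟨?_, ?_⟩
  · have h0 : ∀ ε : ℝ, 0 < ε → |coneHardyConst N (π / 2) - (N : ℝ) ^ 2 / 4| ≤ 0 + ε := by
      intro ε hε
      obtain ⟨δ, hδ, h⟩ := two_sided hN hε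
      rw [zero_add]
      apply h
      rw [Real.cos_pi_div_two, abs_zero]
      exact hδ
    have h1 := le_of_forall_pos_le_add h0
    exact sub_eq_zero.1 (abs_nonpos_iff.1 h1)
  · intro ε hε
    obtain ⟨δ, hδ, h⟩ := two_sided hN (half_pos hε)
    refine ⟨δ, hδ, fun γ _ hγ => ?_⟩
    have hc : |Real.cos γ| ≤ |γ - π / 2| := by
      rw [← Real.sin_pi_div_two_sub, abs_sub_comm γ]
      exact Real.abs_sin_le_abs
    have := h γ (hc.trans_lt hγ)
    linarith
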